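/- An n×n matrix with entries in {0, 1, ∗} equals M(Ω) for some Ω ∈ RTSeq_n if and only if the following four conditions hold: (i) the positions of the 1's form a permutation matrix; (ii) each row contains at most one ∗; (iii) every ∗ lies strictly above the 1 in its column and strictly to the left of the 1 in its row; (iv) whenever an entry 0 lies in a row strictly between the ∗ and the 1 of that row, every entry strictly below that 0 in its column is also 0. -/

import Mathlib

/-!
Statement 17.  `RTSeq_n` is the set of sequences `Ω = X₁⋯X_n` of formal letters with
`X_s ∈ {r₁, t₁, …, r_{s−1}, t_{s−1}, r_s}` (here `RTLetter.r k` stands for `r_{k+1}` and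
`RTLetter.t k` for `t_{k+1}`).  `M(Ω)` is the `n×n` matrix with entries in `{0, 1, ∗}`
built by the recursion: `M(∅)` is the `0×0` matrix; `M(Ω′ r_i)` prepends a first row with
a `1` in column `i` and inserts an all-zero column at position `i`; `M(Ω′ t_i)` prepends a
first row with `∗` in column `i` and `1` in column `i+1`, and inserts an all-zero column
at position `i+1` (columns 1-indexed).  The claim: an `n×n` matrix over `{0, 1, ∗}` is
`M(Ω)` for some `Ω ∈ RTSeq_n` iff (i) the `1`s form a permutation matrix; (ii) each row
has at most one `∗`; (iii) every `∗` is strictly above the `1` of its column and strictly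
left of the `1` of its row; (iv) for every `0` strictly between the `∗` and the `1` of its
row, all entries strictly below that `0` are `0`.
-/

/-- The three possible matrix entries `0, 1, ∗`. -/
inductive Entry : Type
  | zero : Entry
  | one : Entry
  | star : Entry
deriving DecidableEq

/-- The formal letters `r_j, t_j` (`j ≥ 1`); `RTLetter.r k` stands for `r_{k+1}`,
`RTLetter.t k` for `t_{k+1}`. -/
inductive RTLetter : Type
  | r : ℕ → RTLetter
  | t : ℕ → RTLetter
deriving DecidableEq

/-- The letter at (0-indexed) position `p` of a sequence in `RTSeq_n` must lie in
`{r₁, t₁, …, r_p, t_p, r_{p+1}}` (1-indexed position `s = p+1`). -/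
def validLetter (p : ℕ) : RTLetter → Prop
  | .r k => k ≤ p
  | .t k => k + 1 ≤ p

/-- `Ω ∈ RTSeq_n`: a sequence of `n` letters `X₁⋯X_n` with
`X_s ∈ {r₁, t₁, …, r_{s−1}, t_{s−1}, r_s}`. -/
def validSeq (n : ℕ) (L : List RTLetter) : Prop :=
  L.length = n ∧ ∀ p < L.length, validLetter p (L.getD p (.r 0))

/-- The entry in row `i`, column `j` (`0`-indexed) of the matrix `M(Ω)`, where the list
argument is the *reverse* of `Ω` (so that the recursion peels off the last letter of `Ω`).
For `r_i` (letter `r k`, `k = i−1`): first row has `1` in column `k`; a zero column is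
inserted at position `k`.  For `t_i` (letter `t k`): first row has `∗` in column `k` and
`1` in column `k+1`; a zero column is inserted at position `k+1`. -/
def Mfun : List RTLetter → ℕ → ℕ → Entry
  | [], _, _ => .zero
  | (.r k :: L'), i, j =>
      if i = 0 then (if j = k then .one else .zero)
      else if j < k then Mfun L' (i - 1) j
      else if j = k then .zero
      else Mfun L' (i - 1) (j - 1)
  | (.t k :: L'), i, j =>
      if i = 0 then (if j = k then .star else if j = k + 1 then .one else .zero)
      else if j ≤ k then Mfun L' (i - 1) j
      else if j = k + 1 then .zero
      else Mfun L' (i - 1) (j - 1)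

/-- Representability of `A` as the matrix of a sequence in `RTSeq_n`. -/
def IsRTMatrix (n : ℕ) (A : Matrix (Fin n) (Fin n) Entry) : Prop :=
  ∃ L : List RTLetter, validSeq n L ∧ ∀ i j : Fin n, A i j = Mfun L.reverse i j

/-- The four conditions characterizing the matrices of sequences in `RTSeq_n`. -/
def IsAdmissible (n : ℕ) (A : Matrix (Fin n) (Fin n) Entry) : Prop :=
  ((∀ i : Fin n, ∃! j : Fin n, A i j = .one) ∧
    (∀ j : Fin n, ∃! i : Fin n, A i j = .one)) ∧
  (∀ i j j' : Fin n, A i j = .star → A i j' = .star → j = j') ∧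
  (∀ i j : Fin n, A i j = .star →
    (∀ i' : Fin n, A i' j = .one → i < i') ∧ (∀ j' : Fin n, A i j' = .one → j < j')) ∧
  (∀ i j j₁ j₂ : Fin n, A i j₁ = .star → A i j₂ = .one → j₁ < j → j < j₂ →
    A i j = .zero → ∀ i' : Fin n, i < i' → A i' j = .zero)

/-- The first row of `A` has its `1` in column `k`, the rest of that column vanishes, and the
remaining entries of the first row vanish except possibly a `∗` immediately left of the `1`. -/
structure IsHead {n : ℕ} (A : Matrix (Fin (n + 1)) (Fin (n + 1)) Entry) (k : Fin (n + 1)) :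
    Prop where
  one : A 0 k = .one
  column : ∀ i : Fin n, A i.succ k = .zero
  row : (∀ j, j ≠ k → A 0 j = .zero) ∨
    ∃ c : Fin (n + 1), c.val + 1 = k.val ∧ A 0 c = .star ∧ ∀ j, j ≠ k → j ≠ c → A 0 j = .zero

/-- Delete the first row and column `k`. -/
def headMinor {n : ℕ} (A : Matrix (Fin (n + 1)) (Fin (n + 1)) Entry) (k : Fin (n + 1)) :
    Matrix (Fin n) (Fin n) Entry :=
  fun i j => A i.succ (k.succAbove j)

namespace IsHead

variable {n : ℕ} {A : Matrix (Fin (n + 1)) (Fin (n + 1)) Entry} {k : Fin (n + 1)}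

theorem eq_of_one (h : IsHead A k) {j : Fin (n + 1)} (hj : A 0 j = .one) : j = k := by
  by_contra hne
  rcases h.row with h0 | ⟨c, -, hc, h0⟩
  · simp [h0 j hne] at hj
  · by_cases hjc : j = c
    · subst hjc; simp [hc] at hj
    · simp [h0 j hne hjc] at hj

theorem succ_of_star (h : IsHead A k) {j : Fin (n + 1)} (hj : A 0 j = .star) :
    j.val + 1 = k.val := by
  have hne : j ≠ k := by
    rintro rfl
    simp [h.one] at hj
  rcases h.row with h0 | ⟨c, hck, hc, h0⟩
  · simp [h0 j hne] at hj
  · by_cases hjc : j = c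
    · subst hjc; exact hck
    · simp [h0 j hne hjc] at hj

theorem admissible_headMinor (h : IsHead A k) (hA : IsAdmissible (n + 1) A) :
    IsAdmissible n (headMinor A k) := by
  obtain ⟨⟨hr, hc⟩, hs, hl, hz⟩ := hA
  refine ⟨⟨fun i => ?_, fun j => ?_⟩, fun i j j' h1 h2 => ?_, fun i j h1 => ⟨?_, ?_⟩, ?_⟩
  · obtain ⟨j, hj, hu⟩ := hr i.succ
    have hjk : j ≠ k := by
      rintro rfl
      simp [h.column] at hj
    obtain ⟨j', rfl⟩ := Fin.exists_succAbove_eq hjk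
    exact ⟨j', hj, fun y hy => Fin.succAbove_right_injective (hu _ hy)⟩
  · obtain ⟨i, hi, hu⟩ := hc (k.succAbove j)
    cases i using Fin.cases with
    | zero => exact absurd (h.eq_of_one hi) (Fin.succAbove_ne _ _)
    | succ i => exact ⟨i, hi, fun y hy => Fin.succ_injective _ (hu _ hy)⟩
  · exact Fin.succAbove_right_injective (hs _ _ _ h1 h2)
  · exact fun i' h2 => Fin.succ_lt_succ_iff.1 ((hl _ _ h1).1 _ h2)
  · exact fun j' h2 => Fin.succAbove_lt_succAbove_iff.1 ((hl _ _ h1).2 _ h2)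
  · intro i j j₁ j₂ h1 h2 h3 h4 h5 i' h6
    exact hz _ _ _ _ h1 h2 (Fin.succAbove_lt_succAbove_iff.2 h3)
      (Fin.succAbove_lt_succAbove_iff.2 h4) h5 _ (Fin.succ_lt_succ_iff.2 h6)

theorem admissible (h : IsHead A k) (hA : IsAdmissible n (headMinor A k)) :
    IsAdmissible (n + 1) A := by
  obtain ⟨⟨hr, hc⟩, hs, hl, hz⟩ := hA
  have below : ∀ {i : Fin n} {j : Fin (n + 1)}, A i.succ j ≠ .zero →
      ∃ j', k.succAbove j' = j := fun hij =>
    Fin.exists_succAbove_eq (by rintro rfl; exact hij (h.column _))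
  refine ⟨⟨fun i => ?_, fun j => ?_⟩, fun i j j' h1 h2 => ?_, fun i j h1 => ⟨?_, ?_⟩, ?_⟩
  · cases i using Fin.cases with
    | zero => exact ⟨k, h.one, fun y hy => h.eq_of_one hy⟩
    | succ i =>
      obtain ⟨j, hj, hu⟩ := hr i
      refine ⟨k.succAbove j, hj, fun y hy => ?_⟩
      obtain ⟨y, rfl⟩ := below (by simp [hy] : A i.succ y ≠ .zero)
      rw [hu y hy]
  · by_cases hjk : j = k
    · subst hjk
      refine ⟨0, h.one, fun y hy => ?_⟩
      cases y using Fin.cases with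
      | zero => rfl
      | succ y => simp [h.column] at hy
    · obtain ⟨j, rfl⟩ := Fin.exists_succAbove_eq hjk
      obtain ⟨i, hi, hu⟩ := hc j
      refine ⟨i.succ, hi, fun y hy => ?_⟩
      cases y using Fin.cases with
      | zero => exact absurd (h.eq_of_one hy) hjk
      | succ y => rw [hu y hy]
  · cases i using Fin.cases with
    | zero =>
      have e1 := h.succ_of_star h1
      have e2 := h.succ_of_star h2
      exact Fin.ext (by omega)
    | succ i =>
      obtain ⟨j, rfl⟩ := below (by simp [h1] : A i.succ j ≠ .zero)
      obtain ⟨j', rfl⟩ := below (by simp [h2] : A i.succ j' ≠ .zero)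
      rw [hs i j j' h1 h2]
  · intro i' h2
    cases i' using Fin.cases with
    | zero =>
      obtain rfl := h.eq_of_one h2
      cases i using Fin.cases with
      | zero => simp [h2] at h1
      | succ i => simp [h.column] at h1
    | succ i' =>
      cases i using Fin.cases with
      | zero => exact Fin.succ_pos _
      | succ i =>
        obtain ⟨j, rfl⟩ := below (by simp [h1] : A i.succ j ≠ .zero)
        exact Fin.succ_lt_succ_iff.2 ((hl i j h1).1 i' h2)
  · intro j' h2
    cases i using Fin.cases with
    | zero =>
      obtain rfl := h.eq_of_one h2
      have e1 := h.succ_of_star h1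
      exact Fin.lt_def.2 (by omega)
    | succ i =>
      obtain ⟨j, rfl⟩ := below (by simp [h1] : A i.succ j ≠ .zero)
      obtain ⟨j', rfl⟩ := below (by simp [h2] : A i.succ j' ≠ .zero)
      exact Fin.succAbove_lt_succAbove_iff.2 ((hl i j h1).2 j' h2)
  · intro i j j₁ j₂ h1 h2 h3 h4 h5 i' h6
    cases i using Fin.cases with
    | zero =>
      obtain rfl := h.eq_of_one h2
      have e1 := h.succ_of_star h1
      rw [Fin.lt_def] at h3 h4
      omega
    | succ i =>
      cases i' using Fin.cases with
      | zero => exact absurd h6 (Fin.not_lt_zero _)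
      | succ i' =>
        by_cases hjk : j = k
        · subst hjk; exact h.column _
        · obtain ⟨j, rfl⟩ := Fin.exists_succAbove_eq hjk
          obtain ⟨j₁, rfl⟩ := below (by simp [h1] : A i.succ j₁ ≠ .zero)
          obtain ⟨j₂, rfl⟩ := below (by simp [h2] : A i.succ j₂ ≠ .zero)
          exact hz i j j₁ j₂ h1 h2 (Fin.succAbove_lt_succAbove_iff.1 h3)
            (Fin.succAbove_lt_succAbove_iff.1 h4) h5 i' (Fin.succ_lt_succ_iff.1 h6)

end IsHead

theorem IsAdmissible.exists_isHead {n : ℕ} {A : Matrix (Fin (n + 1)) (Fin (n + 1)) Entry}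
    (hA : IsAdmissible (n + 1) A) : ∃ k, IsHead A k := by
  obtain ⟨⟨hr, hc⟩, hs, hl, hz⟩ := hA
  obtain ⟨k, hk, hku⟩ := hr 0
  refine ⟨k, hk, fun i => ?_, ?_⟩
  · cases e : A i.succ k with
    | zero => rfl
    | one => exact absurd ((hc k).unique e hk) (Fin.succ_ne_zero i)
    | star => exact absurd ((hl _ _ e).1 _ hk) (Fin.not_lt_zero _)
  · by_cases hst : ∃ c, A 0 c = .star
    · obtain ⟨c, hcs⟩ := hst
      have hz0 : ∀ j, j ≠ k → j ≠ c → A 0 j = .zero := fun j hjk hjc => by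
        cases e : A 0 j with
        | zero => rfl
        | one => exact absurd (hku j e) hjk
        | star => exact absurd (hs _ _ _ e hcs) hjc
      refine .inr ⟨c, ?_, hcs, hz0⟩
      have hck : c.val < k.val := (hl _ _ hcs).2 _ hk
      by_contra hne
      let j : Fin (n + 1) := ⟨c.val + 1, by omega⟩
      have hcj : c < j := Fin.lt_def.2 (by simp [j])
      have hjk : j < k := Fin.lt_def.2 (by simp only [j]; omega)
      have hj := hz0 j hjk.ne hcj.ne'
      obtain ⟨i, hi, -⟩ := hc j
      cases i using Fin.cases with
      | zero => simp [hj] at hi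
      | succ i => simp [hz 0 j c k hcs hk hcj hjk hj i.succ (Fin.succ_pos i)] at hi
    · refine .inl fun j hjk => ?_
      cases e : A 0 j with
      | zero => rfl
      | one => exact absurd (hku j e) hjk
      | star => exact absurd ⟨j, e⟩ hst

theorem isAdmissible_succ_iff {n : ℕ} (A : Matrix (Fin (n + 1)) (Fin (n + 1)) Entry) :
    IsAdmissible (n + 1) A ↔ ∃ k, IsHead A k ∧ IsAdmissible n (headMinor A k) :=
  ⟨fun hA => hA.exists_isHead.imp fun _ hk => ⟨hk, hk.admissible_headMinor hA⟩,
    fun ⟨_, hk, hA⟩ => hk.admissible hA⟩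

theorem validSeq_append_singleton (n : ℕ) (L : List RTLetter) (X : RTLetter) :
    validSeq (n + 1) (L ++ [X]) ↔ validSeq n L ∧ validLetter n X := by
  constructor
  · rintro ⟨hl, hv⟩
    have hl' : L.length = n := by simpa using hl
    refine ⟨⟨hl', fun p hp => ?_⟩, ?_⟩
    · have := hv p (by simp; omega)
      rwa [List.getD_append _ _ _ _ hp] at this
    · have := hv n (by simp [hl'])
      rw [List.getD_append_right _ _ _ _ hl'.le] at this
      simpa [hl'] using this
  · rintro ⟨⟨rfl, hv⟩, hX⟩
    refine ⟨by simp, fun p hp => ?_⟩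
    rcases Nat.lt_or_ge p L.length with h | h
    · rw [List.getD_append _ _ _ _ h]
      exact hv p h
    · obtain rfl : p = L.length := by
        simp at hp
        omega
      simpa [List.getD_append_right] using hX

theorem Fin.val_succAbove_eq_ite {n : ℕ} (k : Fin (n + 1)) (j : Fin n) :
    (k.succAbove j).val = if j.val < k.val then j.val else j.val + 1 := by
  by_cases h : j.val < k.val <;> simp [Fin.succAbove, Fin.lt_def, h]

/-- Inserting a zero column at `k` below a first row `a` that is `1` exactly at `k`. -/
theorem eq_insert_iff {n : ℕ} (A : Matrix (Fin (n + 1)) (Fin (n + 1)) Entry) (k : Fin (n + 1))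
    (a : ℕ → Entry) (B : ℕ → ℕ → Entry) :
    (∀ i j : Fin (n + 1), A i j = if i.val = 0 then a j else if j.val < k.val then B (i - 1) j
      else if j.val = k.val then .zero else B (i - 1) (j - 1)) ↔
    (∀ j : Fin (n + 1), A 0 j = a j) ∧ (∀ i : Fin n, A i.succ k = .zero) ∧
      ∀ i j : Fin n, headMinor A k i j = B i j := by
  rw [Fin.forall_fin_succ]
  simp only [Fin.val_zero, if_true, Fin.val_succ, Nat.add_one_ne_zero, if_false,
    Nat.add_sub_cancel, headMinor]
  refine and_congr_right fun _ => ?_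
  rw [← forall_and]
  refine forall_congr' fun i => ?_
  rw [Fin.forall_iff_succAbove k]
  refine and_congr (by simp) (forall_congr' fun j => ?_)
  rw [Fin.val_succAbove_eq_ite]
  by_cases h : j.val < k.val
  · simp [h]
  · rw [if_neg h, if_neg (by omega), if_neg (by omega)]
    simp

theorem IsRTMatrix.exists_isHead {n : ℕ} {A : Matrix (Fin (n + 1)) (Fin (n + 1)) Entry}
    (hA : IsRTMatrix (n + 1) A) : ∃ k, IsHead A k ∧ IsRTMatrix n (headMinor A k) := by
  obtain ⟨L, hL, hM⟩ := hA
  rcases List.eq_nil_or_concat' L with rfl | ⟨L, X, rfl⟩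
  · simp [validSeq] at hL
  rw [validSeq_append_singleton] at hL
  obtain ⟨hL, hX⟩ := hL
  simp only [List.reverse_append, List.reverse_singleton, List.singleton_append] at hM
  cases X with
  | r k =>
    have hk : k < n + 1 := Nat.lt_succ_of_le hX
    obtain ⟨h0, hc, hm⟩ := (eq_insert_iff A ⟨k, hk⟩ (fun j => if j = k then .one else .zero)
      (Mfun L.reverse)).1 hM
    refine ⟨⟨k, hk⟩, ⟨by simp [h0], hc, .inl fun j hj => ?_⟩, L, hL, hm⟩
    rw [h0, if_neg (fun e => hj (Fin.ext e))]
  | t k =>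
    have hk : k + 1 < n + 1 := Nat.lt_succ_of_le hX
    obtain ⟨h0, hc, hm⟩ := (eq_insert_iff A ⟨k + 1, hk⟩
      (fun j => if j = k then .star else if j = k + 1 then .one else .zero)
      (Mfun L.reverse)).1 (by simpa only [Mfun, Nat.lt_succ_iff] using hM)
    refine ⟨⟨k + 1, hk⟩, ⟨by simp [h0], hc,
      .inr ⟨⟨k, by omega⟩, rfl, by simp [h0], fun j hj hj' => ?_⟩⟩, L, hL, hm⟩
    rw [h0, if_neg (fun e => hj' (Fin.ext e)), if_neg (fun e => hj (Fin.ext e))]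

theorem IsHead.isRTMatrix {n : ℕ} {A : Matrix (Fin (n + 1)) (Fin (n + 1)) Entry}
    {k : Fin (n + 1)} (h : IsHead A k) (hA : IsRTMatrix n (headMinor A k)) :
    IsRTMatrix (n + 1) A := by
  obtain ⟨L, hL, hM⟩ := hA
  rcases h.row with h0 | ⟨c, hck, hc, h0⟩
  · refine ⟨L ++ [.r k], (validSeq_append_singleton n L (.r k)).2 ⟨hL, Nat.le_of_lt_succ k.2⟩, ?_⟩
    simp only [List.reverse_append, List.reverse_singleton, List.singleton_append]
    refine (eq_insert_iff A k (fun j => if j = k then .one else .zero) _).2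
      ⟨fun j => ?_, h.column, hM⟩
    by_cases hj : j = k
    · simp [hj, h.one]
    · simp [h0 j hj, Fin.val_inj, hj]
  · refine ⟨L ++ [.t c], (validSeq_append_singleton n L (.t c)).2
      ⟨hL, show c.val + 1 ≤ n by omega⟩, ?_⟩
    simp only [List.reverse_append, List.reverse_singleton, List.singleton_append]
    have := (eq_insert_iff A k
      (fun j => if j = c then .star else if j = k then .one else .zero) (Mfun L.reverse)).2
      ⟨fun j => ?_, h.column, hM⟩
    · simpa only [Mfun, ← hck, Nat.lt_succ_iff] using this
    · by_cases hj' : j = c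
      · simp [hj', hc]
      · by_cases hj : j = k
        · subst hj; simp [h.one, Fin.val_inj, hj']
        · simp [h0 j hj hj', Fin.val_inj, hj, hj']

theorem isRTMatrix_iff_isAdmissible (n : ℕ) (A : Matrix (Fin n) (Fin n) Entry) :
    IsRTMatrix n A ↔ IsAdmissible n A := by
  induction n with
  | zero => exact ⟨fun _ => by simp [IsAdmissible], fun _ => ⟨[], by simp [validSeq], by simp⟩⟩
  | succ n ih =>
    rw [isAdmissible_succ_iff]
    simp only [← ih]
    exact ⟨fun hA => hA.exists_isHead, fun ⟨_, hk, hA⟩ => hk.isRTMatrix hA⟩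

theorem stmt17 (n : ℕ) (A : Matrix (Fin n) (Fin n) Entry) :
    (∃ L : List RTLetter, validSeq n L ∧ ∀ i j : Fin n, A i j = Mfun L.reverse i j) ↔
      ((∀ i : Fin n, ∃! j : Fin n, A i j = .one) ∧
        (∀ j : Fin n, ∃! i : Fin n, A i j = .one)) ∧
      (∀ i j j' : Fin n, A i j = .star → A i j' = .star → j = j') ∧
      (∀ i j : Fin n, A i j = .star →
        (∀ i' : Fin n, A i' j = .one → i < i') ∧ (∀ j' : Fin n, A i j' = .one → j < j')) ∧
      (∀ i j j₁ j₂ : Fin n, A i j₁ = .star → A i j₂ = .one → j₁ < j → j < j₂ →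
        A i j = .zero → ∀ i' : Fin n, i < i' → A i' j = .zero) :=
  isRTMatrix_iff_isAdmissible n A
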